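/- Let A be an invertible real N×N matrix with (A⁻¹)_{kk} ≠ 0 for a fixed index k, let f ∈ ℝᴺ, and let λ = A⁻¹f. Suppose the (N−1)×(N−1) matrix A⁽ᵏ⁾ obtained from A by deleting row k and column k is invertible, and let μ ∈ ℝ^{N−1} be the unique solution of A⁽ᵏ⁾ μ = f⁽ᵏ⁾, where f⁽ᵏ⁾ is f with its k-th entry deleted. Define s⁽ᵏ⁾ₖ = Σ_{j ≠ k} A_{kj} μ_j. Then the leave-one-out residual satisfies f_k − s⁽ᵏ⁾ₖ = λ_k / (A⁻¹)_{kk}. -/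

import Mathlib

open Matrix

/-- Extending `μ` by zero at `k` turns the matrix-vector product into a sum over `j ≠ k`. -/
theorem mulVec_extend_zero {ι R : Type*} [Fintype ι] [DecidableEq ι] [NonUnitalNonAssocSemiring R]
    (A : Matrix ι ι R) (k : ι) (μ : {j : ι // j ≠ k} → R) (i : ι) :
    (A *ᵥ fun j => if h : j ≠ k then μ ⟨j, h⟩ else 0) i =
      ∑ j : {j : ι // j ≠ k}, A i j.1 * μ j := by
  rw [mulVec, dotProduct, Fintype.sum_eq_add_sum_subtype_ne _ k]
  have h : ∀ j : {j : ι // j ≠ k}, (j : ι) ≠ k := fun j => j.2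
  simp [h]

/-- **Rippa's LOOCV identity.**  Let `A` be an invertible real `N × N` matrix
with `(A⁻¹) k k ≠ 0`, let `f : ℝᴺ` and `lam = A⁻¹ *ᵥ f`.  Suppose the principal
submatrix `A⁽ᵏ⁾` obtained by deleting row and column `k` is invertible and
`μ` solves `A⁽ᵏ⁾ *ᵥ μ = f⁽ᵏ⁾`.  With `s⁽ᵏ⁾ₖ = ∑_{j ≠ k} A k j * μ j`, the
leave-one-out residual satisfies `f k - s⁽ᵏ⁾ₖ = lam k / (A⁻¹) k k`. -/
theorem rippa_loocv_identity
    {N : ℕ} (A : Matrix (Fin N) (Fin N) ℝ) (hA : IsUnit A) (k : Fin N)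
    (hk : A⁻¹ k k ≠ 0) (f : Fin N → ℝ)
    (hAk : IsUnit (A.submatrix (Subtype.val : {j : Fin N // j ≠ k} → Fin N)
        (Subtype.val : {j : Fin N // j ≠ k} → Fin N)))
    (μ : {j : Fin N // j ≠ k} → ℝ)
    (hμ : (A.submatrix (Subtype.val : {j : Fin N // j ≠ k} → Fin N)
        (Subtype.val : {j : Fin N // j ≠ k} → Fin N)) *ᵥ μ =
        fun j : {j : Fin N // j ≠ k} => f j.1) :
    f k - ∑ j : {j : Fin N // j ≠ k}, A k j.1 * μ j = (A⁻¹ *ᵥ f) k / A⁻¹ k k := by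
  set v : Fin N → ℝ := fun j => if h : j ≠ k then μ ⟨j, h⟩ else 0 with hv
  set e : ℝ := f k - ∑ j : {j : Fin N // j ≠ k}, A k j.1 * μ j with he
  have hf : f = A *ᵥ v + Pi.single k e := by
    funext i
    rw [Pi.add_apply, hv, mulVec_extend_zero]
    by_cases hi : i = k
    · subst hi
      simp [he]
    · have := congrFun hμ ⟨i, hi⟩
      simp only [mulVec, dotProduct, submatrix_apply] at this
      simp [hi, this]
  have hdet : IsUnit A.det := (isUnit_iff_isUnit_det A).mp hA
  have hlam : (A⁻¹ *ᵥ f) k = A⁻¹ k k * e := by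
    rw [hf, mulVec_add, mulVec_mulVec, nonsing_inv_mul A hdet, one_mulVec]
    simp [hv, mul_comm]
  rw [hlam, mul_div_cancel_left₀ e hk]
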